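/- arXiv:2203.02466 — 3 statements merged into one kernel-verified Lean document; each statement's English description precedes it below -/
import Mathlib

section
/- Let Θ be a finite set with θ° ∈ Θ, let π be a probability mass function on Θ, let A = [a_{ℓk}] ∈ ℝ^{K×K} be left-stochastic (a_{ℓk} ≥ 0, Σ_ℓ a_{ℓk} = 1 for each k) with a vector v satisfying Av = v, 1ᵀv = 1, v ≻ 0, and let ψ_1,…,ψ_K be strictly positive probability mass functions on Θ. For each τ ∈ Θ and agents k, ℓ define the bootstrapped value ψ̂^{(k,τ)}_ℓ(θ°) := ψ_ℓ(θ°)/(1 − ψ_k(τ) + ψ_ℓ(τ)) if θ° = τ, and ψ̂^{(k,τ)}_ℓ(θ°) := ψ_k(θ°)/(1 − ψ_k(τ) + ψ_ℓ(τ)) if θ° ≠ τ. Then Σ_{τ∈Θ} π_τ Σ_{k=1}^K v_k Σ_{ℓ=1}^K a_{ℓk} log ψ̂^{(k,τ)}_ℓ(θ°) ≥ Σ_{k=1}^K v_k log ψ_k(θ°). -/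
open MeasureTheory ProbabilityTheory Filter

/-- Real-valued Kullback-Leibler divergence between two densities `p`, `q`
with respect to a dominating sigma-finite measure `ν`. -/
noncomputable def klReal {X : Type*} [MeasurableSpace X] (ν : Measure X) (p q : X → ℝ) : ℝ :=
  ∫ x, p x * Real.log (p x / q x) ∂ν

/-- If `v` is fixed by `A`, averaging `f` over the network leaves its `v`-average unchanged. -/
theorem sum_mul_sum_eq_of_mulVec_eq {ι : Type*} [Fintype ι] {A : Matrix ι ι ℝ} {v : ι → ℝ}
    (hv : A.mulVec v = v) (f : ι → ℝ) :
    ∑ k, v k * ∑ l, A l k * f l = ∑ k, v k * f k := by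
  simp_rw [Finset.mul_sum]
  rw [Finset.sum_comm]
  refine Finset.sum_congr rfl fun l _ => ?_
  conv_rhs => rw [← hv]
  simp only [Matrix.mulVec, dotProduct, Finset.sum_mul]
  exact Finset.sum_congr rfl fun k _ => by ring

/-- `log x ≤ x - 1` applied to the denominator of a bootstrapped belief. -/
theorem log_sub_le_log_div {x p q : ℝ} (hx : 0 < x) (hp : p ≤ 1) (hq : 0 < q) :
    Real.log x - (q - p) ≤ Real.log (x / (1 - p + q)) := by
  have hd : 0 < 1 - p + q := by linarith
  rw [Real.log_div hx.ne' hd.ne']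
  linarith [Real.log_le_sub_one_of_pos hd]

/-- the key deterministic inequality behind the super-martingale
property: averaging the bootstrapped log-beliefs at θ° over the trending
hypothesis τ ~ π and over the network is at least the Perron-weighted average
of the log-beliefs at θ°. -/
theorem bootstrapped_average_log_inequality
    (K H : ℕ) (hK : 0 < K) (hH : 0 < H)
    (πv : Fin H → ℝ) (hπnn : ∀ θ, 0 ≤ πv θ) (hπ1 : ∑ θ, πv θ = 1)
    (A : Matrix (Fin K) (Fin K) ℝ)
    (hAnn : ∀ l k, 0 ≤ A l k) (hAcol : ∀ k, ∑ l, A l k = 1)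
    (v : Fin K → ℝ) (hv : A.mulVec v = v) (hv1 : ∑ k, v k = 1) (hvpos : ∀ k, 0 < v k)
    (θ0 : Fin H)
    (ψ : Fin K → Fin H → ℝ) (hψpos : ∀ k θ, 0 < ψ k θ) (hψpmf : ∀ k, ∑ θ, ψ k θ = 1) :
    (∑ k, v k * Real.log (ψ k θ0)) ≤
      ∑ τ, πv τ * ∑ k, v k * ∑ l, A l k *
        Real.log (if θ0 = τ then ψ l θ0 / (1 - ψ k τ + ψ l τ)
                  else ψ k θ0 / (1 - ψ k τ + ψ l τ)) := by
  have hle (k : Fin K) (τ : Fin H) : ψ k τ ≤ 1 := by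
    rw [← hψpmf k]
    exact Finset.single_le_sum (fun θ _ => (hψpos k θ).le) (Finset.mem_univ τ)
  have hconst (k : Fin K) (c : ℝ) : ∑ l, A l k * c = c := by
    rw [← Finset.sum_mul, hAcol, one_mul]
  suffices h : ∑ τ, πv τ * ∑ k, v k * Real.log (ψ k θ0) ≤ _ by
    rwa [← Finset.sum_mul, hπ1, one_mul] at h
  refine Finset.sum_le_sum fun τ _ => mul_le_mul_of_nonneg_left ?_ (hπnn τ)
  calc ∑ k, v k * Real.log (ψ k θ0)
      = ∑ k, v k * ∑ l, A l k *
          (Real.log (if θ0 = τ then ψ l θ0 else ψ k θ0) - (ψ l τ - ψ k τ)) := by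
        have hdrift := sum_mul_sum_eq_of_mulVec_eq hv fun k => ψ k τ
        have hlog := sum_mul_sum_eq_of_mulVec_eq hv fun k => Real.log (ψ k θ0)
        split_ifs <;>
          simp only [mul_sub, Finset.sum_sub_distrib, hconst] <;> linarith
    _ ≤ _ := by
        refine Finset.sum_le_sum fun k _ => mul_le_mul_of_nonneg_left ?_ (hvpos k).le
        refine Finset.sum_le_sum fun l _ => mul_le_mul_of_nonneg_left ?_ (hAnn l k)
        split_ifs <;> exact log_sub_le_log_div (hψpos _ _) (hle k τ) (hψpos l τ)
end

section
/- Let Θ be a finite set, θ° ∈ Θ, μ a strictly positive probability mass function on Θ, and let {L(·|θ)}_{θ∈Θ} be probability density functions on a measurable space with respect to a σ-finite measure ν, with D_KL(L(·|θ°) ‖ L(·|θ)) < ∞ for all θ ∈ Θ. For an observation ξ define the Bayesian update ψ_ξ(θ) := L(ξ|θ)μ(θ) / Σ_{θ'∈Θ} L(ξ|θ')μ(θ'). Then, when ξ is distributed according to the density L(·|θ°), E[log ψ_ξ(θ°)] − log μ(θ°) = D_KL( L(·|θ°) ‖ Σ_{θ'∈Θ} μ(θ') L(·|θ') ) ≥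 0; in particular E[log ψ_ξ(θ°)] ≥ log μ(θ°). -/
open MeasureTheory ProbabilityTheory Filter

/-- The pointwise Gibbs inequality, for `m` dominating a positive multiple of `p`. -/
theorem sub_le_mul_log_div {p m c : ℝ} (hp : 0 ≤ p) (hc : 0 < c) (hcm : c * p ≤ m) :
    p - m ≤ p * Real.log (p / m) := by
  rcases hp.eq_or_lt with rfl | hp
  · simpa using hcm
  have hm : 0 < m := (mul_pos hc hp).trans_le hcm
  have h := Real.one_sub_inv_le_log_of_pos (div_pos hp hm)
  calc p - m = p * (1 - (p / m)⁻¹) := by field_simp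
    _ ≤ p * Real.log (p / m) := by gcongr

/-- If `m` dominates `c * p` for some `c > 0`, the divergence integrand of `p` from `m` is at most
`-log c * p`. -/
theorem mul_log_div_le {p m c : ℝ} (hp : 0 ≤ p) (hc : 0 < c) (hcm : c * p ≤ m) :
    p * Real.log (p / m) ≤ p * (-Real.log c) := by
  rcases hp.eq_or_lt with rfl | hp
  · simp
  have hm : 0 < m := (mul_pos hc hp).trans_le hcm
  rw [← Real.log_inv]
  gcongr
  rw [div_le_iff₀ hm, inv_mul_eq_div, le_div_iff₀ hc]
  linarith

/-- The divergence integrand is integrable when the reference density dominates a positive multiple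
of the first density. -/
theorem integrable_mul_log_div {X : Type*} [MeasurableSpace X] {ν : Measure X} {p m : X → ℝ}
    {c : ℝ} (hp : ∀ x, 0 ≤ p x) (hc : 0 < c) (hcm : ∀ x, c * p x ≤ m x)
    (hpi : Integrable p ν) (hmi : Integrable m ν) :
    Integrable (fun x => p x * Real.log (p x / m x)) ν := by
  refine integrable_of_le_of_le (f := fun x => p x * Real.log (p x / m x))
    (hpi.aestronglyMeasurable.mul ?_) (ae_of_all _ fun x => sub_le_mul_log_div (hp x) hc (hcm x))
    (ae_of_all _ fun x => mul_log_div_le (hp x) hc (hcm x))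
    (hpi.sub hmi) (hpi.mul_const _)
  exact (Real.measurable_log.comp_aemeasurable
    (hpi.aemeasurable.div hmi.aemeasurable)).aestronglyMeasurable

/-- the expected log of the Bayesian update at θ°, under
observations drawn from L(·|θ°), exceeds log μ(θ°) by exactly the KL divergence
between L(·|θ°) and the belief-mixture density; in particular it is a gain. -/
theorem bayesian_update_expected_log_gain
    {X : Type*} [MeasurableSpace X] (ν : Measure X) [SigmaFinite ν]
    {Θ : Type*} [Fintype Θ] (θ0 : Θ)
    (μp : Θ → ℝ) (hμpos : ∀ θ, 0 < μp θ) (hμpmf : ∑ θ, μp θ = 1)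
    (L : Θ → X → ℝ) (hLnn : ∀ θ x, 0 ≤ L θ x) (hLmeas : ∀ θ, Measurable (L θ))
    (hLpdf : ∀ θ, ∫ x, L θ x ∂ν = 1)
    (hKLfin : ∀ θ, Integrable (fun x => L θ0 x * Real.log (L θ0 x / L θ x)) ν) :
    ((∫ x, L θ0 x * Real.log (L θ0 x * μp θ0 / ∑ θ', L θ' x * μp θ') ∂ν)
        - Real.log (μp θ0)
      = ∫ x, L θ0 x * Real.log (L θ0 x / ∑ θ', μp θ' * L θ' x) ∂ν) ∧
    (0 ≤ ∫ x, L θ0 x * Real.log (L θ0 x / ∑ θ', μp θ' * L θ' x) ∂ν) ∧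
    (Real.log (μp θ0)
      ≤ ∫ x, L θ0 x * Real.log (L θ0 x * μp θ0 / ∑ θ', L θ' x * μp θ') ∂ν) := by
  have hLint : ∀ θ, Integrable (L θ) ν := fun θ =>
    .of_integral_ne_zero (by rw [hLpdf θ]; exact one_ne_zero)
  have hdom : ∀ x, μp θ0 * L θ0 x ≤ ∑ θ', μp θ' * L θ' x := fun x =>
    Finset.single_le_sum (f := fun θ' => μp θ' * L θ' x)
      (fun θ _ => mul_nonneg (hμpos θ).le (hLnn θ x)) (Finset.mem_univ θ0)
  have hmix : Integrable (fun x => ∑ θ', μp θ' * L θ' x) ν :=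
    integrable_finsetSum _ fun θ _ => (hLint θ).const_mul _
  have hmix1 : ∫ x, ∑ θ', μp θ' * L θ' x ∂ν = 1 := by
    rw [integral_finsetSum _ fun θ _ => (hLint θ).const_mul _]
    simp [integral_const_mul, hLpdf, hμpmf]
  have hint := integrable_mul_log_div (hLnn θ0) (hμpos θ0) hdom (hLint θ0) hmix
  have hnonneg : 0 ≤ ∫ x, L θ0 x * Real.log (L θ0 x / ∑ θ', μp θ' * L θ' x) ∂ν := by
    calc 0 = ∫ x, (L θ0 x - ∑ θ', μp θ' * L θ' x) ∂ν := by
          rw [integral_sub (hLint θ0) hmix, hLpdf, hmix1, sub_self]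
      _ ≤ _ := integral_mono ((hLint θ0).sub hmix) hint fun x =>
          sub_le_mul_log_div (hLnn θ0 x) (hμpos θ0) (hdom x)
  have hgain : ∫ x, L θ0 x * Real.log (L θ0 x * μp θ0 / ∑ θ', L θ' x * μp θ') ∂ν
      = (∫ x, L θ0 x * Real.log (L θ0 x / ∑ θ', μp θ' * L θ' x) ∂ν) + Real.log (μp θ0) := by
    have hsplit : ∀ x, L θ0 x * Real.log (L θ0 x * μp θ0 / ∑ θ', L θ' x * μp θ')
        = L θ0 x * Real.log (L θ0 x / ∑ θ', μp θ' * L θ' x) + L θ0 x * Real.log (μp θ0) := by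
      intro x
      simp_rw [mul_comm _ (μp _)]
      rcases (hLnn θ0 x).eq_or_lt with h | h
      · simp [← h]
      have hm := (mul_pos (hμpos θ0) h).trans_le (hdom x)
      rw [mul_div_assoc, Real.log_mul (hμpos θ0).ne' (div_pos h hm).ne']
      ring
    simp_rw [hsplit]
    rw [integral_add hint ((hLint θ0).mul_const _), integral_mul_const, hLpdf, one_mul]
  exact ⟨by rw [hgain, add_sub_cancel_right], hnonneg, by rw [hgain]; linarith⟩
end

section
/- Consider the one-step update of the social learning algorithm with trending hypothesis in the following configuration: for each agent k there is a wrong hypothesis θ_k ∈ Θ ∖ {θ°} such that agent k cannot distinguish θ_k from θ°, i.e. L_k(ξ|θ_k) = L_k(ξ|θ°) for all observations ξ; the current beliefs satisfy μ_{k,i}(θ°) = α, μ_{k,i}(θ_k) = 1 − α, and μ_{k,i}(θ) = 0 for all other θ, for some α ∈ (0,1); and the trending hypothesis at time i+1 equals the truth, τ_{i+1} = θ°. Then for any realization of the observations ξ_{k,i+1} (with L_k(ξ_{k,i+1}|θ°) > 0), the updated beliefs are unchanged: μ_{k,i+1}(θ) = μ_{k,i}(θ) for every agent k and every θ ∈ Θ.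 In particular this belief profile is a fixed point of the algorithm under exclusive truth sharing, so truth sharing alone does not guarantee truth learning. -/
open MeasureTheory ProbabilityTheory Filter

/-- A weighted geometric mean of copies of `c ≥ 0` equals `c`. -/
theorem prod_const_rpow_of_sum_eq_one {ι : Type*} [Fintype ι] {c : ℝ} (hc : 0 ≤ c)
    {w : ι → ℝ} (hw : ∀ i, 0 ≤ w i) (hw1 : ∑ i, w i = 1) : ∏ i, c ^ w i = c := by
  rw [← Real.rpow_sum_of_nonneg hc fun i _ => hw i, hw1, Real.rpow_one]

/-- equilibrium under exclusive truth sharing. If every agent k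
confuses θ° with a wrong hypothesis θ_k, holds belief α on θ°, 1-α on θ_k and 0
elsewhere, and the trending hypothesis is θ°, then one step of the algorithm
leaves all beliefs unchanged. -/
theorem truth_sharing_fixed_point
    (K H : ℕ)
    (A : Matrix (Fin K) (Fin K) ℝ)
    (hAnn : ∀ l k, 0 ≤ A l k) (hAcol : ∀ k, ∑ l, A l k = 1)
    (θ0 : Fin H) (θmap : Fin K → Fin H) (hθmap : ∀ k, θmap k ≠ θ0)
    (α : ℝ) (hα0 : 0 < α) (hα1 : α < 1)
    (Lv : Fin K → Fin H → ℝ) (hLnn : ∀ k θ, 0 ≤ Lv k θ)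
    (hLpos : ∀ k, 0 < Lv k θ0) (hLeq : ∀ k, Lv k (θmap k) = Lv k θ0)
    (μcur : Fin K → Fin H → ℝ)
    (hμ : ∀ k θ, μcur k θ = if θ = θ0 then α else if θ = θmap k then 1 - α else 0)
    (ψ : Fin K → Fin H → ℝ)
    (hψ : ∀ k θ, ψ k θ = Lv k θ * μcur k θ / ∑ θ', Lv k θ' * μcur k θ')
    (μnext : Fin K → Fin H → ℝ)
    (hμnext : ∀ k θ, μnext k θ =
      (∏ l, (if θ = θ0 then ψ l θ / (1 - ψ k θ0 + ψ l θ0)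
             else ψ k θ / (1 - ψ k θ0 + ψ l θ0)) ^ (A l k)) /
      ∑ θ', ∏ l, (if θ' = θ0 then ψ l θ' / (1 - ψ k θ0 + ψ l θ0)
             else ψ k θ' / (1 - ψ k θ0 + ψ l θ0)) ^ (A l k)) :
    ∀ k θ, μnext k θ = μcur k θ := by
  have hμ_nonneg : ∀ k θ, 0 ≤ μcur k θ := by
    intro k θ
    rw [hμ]
    split_ifs <;> linarith
  have hμ_truth : ∀ k, μcur k θ0 = α := fun k => by rw [hμ, if_pos rfl]
  have hμ_sum : ∀ k, ∑ θ, μcur k θ = 1 := by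
    intro k
    have h : ∀ θ, μcur k θ =
        (if θ = θ0 then α else 0) + (if θ = θmap k then 1 - α else 0) := by
      intro θ
      rw [hμ]
      by_cases h0 : θ = θ0
      · simp [h0, (hθmap k).symm]
      · simp [h0]
    simp [h, Finset.sum_add_distrib]
  have hmul : ∀ k θ, Lv k θ * μcur k θ = Lv k θ0 * μcur k θ := by
    intro k θ
    rw [hμ]
    split_ifs with h0 h1
    · rw [h0]
    · rw [h1, hLeq]
    · simp
  have hψμ : ∀ k θ, ψ k θ = μcur k θ := by
    intro k θ
    rw [hψ, Finset.sum_congr rfl fun θ' _ => hmul k θ', ← Finset.mul_sum, hμ_sum, hmul,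
      mul_one, mul_div_cancel_left₀ _ (hLpos k).ne']
  have hprod : ∀ k θ, (∏ l, (if θ = θ0 then ψ l θ / (1 - ψ k θ0 + ψ l θ0)
      else ψ k θ / (1 - ψ k θ0 + ψ l θ0)) ^ (A l k)) = μcur k θ := by
    intro k θ
    have hbase : ∀ l, (if θ = θ0 then ψ l θ / (1 - ψ k θ0 + ψ l θ0)
        else ψ k θ / (1 - ψ k θ0 + ψ l θ0)) = μcur k θ := by
      intro l
      simp only [hψμ, hμ_truth, sub_add_cancel, div_one]
      split_ifs with h0
      · rw [h0, hμ_truth, hμ_truth]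
      · rfl
    simp only [hbase]
    exact prod_const_rpow_of_sum_eq_one (hμ_nonneg k θ) (fun l => hAnn l k) (hAcol k)
  intro k θ
  rw [hμnext, Finset.sum_congr rfl fun θ' _ => hprod k θ', hprod, hμ_sum, div_one]
end
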